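/- Let f, g be as in the standing assumptions. Then the closed relation f ∪ g = {(x, f(x)) : x ∈ [0,a]} ∪ {(x, g(x)) : x ∈ [0,1]} on [0,1] is both CR-turbulent and reverse CR-turbulent. -/

import Mathlib

open Set

/-- The n-th Mahavier product of a relation `F` on `X`: tuples `(x 0, …, x n)`
with `(x i, x (i+1)) ∈ F` for all `i < n`. -/
def Mahavier {X : Type*} (F : Set (X × X)) (n : ℕ) : Set (Fin (n + 1) → X) :=
  {x | ∀ i : Fin n, (x i.castSucc, x i.succ) ∈ F}

/-- A witness of CR-turbulence at length parameter `n`. -/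
def CRWitness {X : Type*} [TopologicalSpace X] (F : Set (X × X)) (n : ℕ) : Prop :=
  ∃ K L : Set (Fin (n + 1) → X),
    K.Nonempty ∧ L.Nonempty ∧ IsClosed K ∧ IsClosed L ∧
    K ⊆ Mahavier F n ∧ L ⊆ Mahavier F n ∧ Disjoint K L ∧
    ((fun x => x 0) '' K ∪ (fun x => x 0) '' L) ⊆
      ((fun x => x (Fin.last n)) '' K ∩ (fun x => x (Fin.last n)) '' L)

/-- A witness of reverse CR-turbulence at length parameter `n`. -/
def RevCRWitness {X : Type*} [TopologicalSpace X] (F : Set (X × X)) (n : ℕ) : Prop :=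
  ∃ K L : Set (Fin (n + 1) → X),
    K.Nonempty ∧ L.Nonempty ∧ IsClosed K ∧ IsClosed L ∧
    K ⊆ Mahavier F n ∧ L ⊆ Mahavier F n ∧ Disjoint K L ∧
    ((fun x => x (Fin.last n)) '' K ∪ (fun x => x (Fin.last n)) '' L) ⊆
      ((fun x => x 0) '' K ∩ (fun x => x 0) '' L)

/-- `F` is CR-turbulent. -/
def CRTurbulent {X : Type*} [TopologicalSpace X] (F : Set (X × X)) : Prop :=
  ∃ n : ℕ, 1 ≤ n ∧ CRWitness F n

/-- `F` is reverse CR-turbulent. -/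
def RevCRTurbulent {X : Type*} [TopologicalSpace X] (F : Set (X × X)) : Prop :=
  ∃ n : ℕ, 1 ≤ n ∧ RevCRWitness F n

/-- A self-map is separated turbulent. -/
def SepTurbulent {Z : Type*} [TopologicalSpace Z] (h : Z → Z) : Prop :=
  ∃ K L : Set Z, K.Nonempty ∧ L.Nonempty ∧ IsClosed K ∧ IsClosed L ∧
    Disjoint K L ∧ K ∪ L ⊆ h '' K ∩ h '' L

/-- A self-map is turbulent. -/
def Turbulent {Z : Type*} [TopologicalSpace Z] (h : Z → Z) : Prop :=
  ∃ K L : Set Z, K.Nonempty ∧ L.Nonempty ∧ IsClosed K ∧ IsClosed L ∧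
    (K ∩ L).Subsingleton ∧ K ∪ L ⊆ h '' K ∩ h '' L

/-- The infinite Mahavier product `X_F^+`. -/
def MahavierSeq {X : Type*} (F : Set (X × X)) : Set (ℕ → X) :=
  {x | ∀ i : ℕ, (x i, x (i + 1)) ∈ F}

/-- The shift map `σ_F^+` on `X_F^+`. -/
def shiftMap {X : Type*} (F : Set (X × X)) : MahavierSeq F → MahavierSeq F :=
  fun x => ⟨fun n => x.1 (n + 1), fun i => x.2 (i + 1)⟩

lemma IsCompact.exists_pos_le_of_forall_pos {X : Type*} [TopologicalSpace X] {S : Set X}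
    (hS : IsCompact S) {h : X → ℝ} (hc : Continuous h) (hpos : ∀ x ∈ S, 0 < h x) :
    ∃ δ > 0, ∀ x ∈ S, δ ≤ h x := by
  rcases S.eq_empty_or_nonempty with rfl | hne
  · exact ⟨1, one_pos, by simp⟩
  · obtain ⟨m, hm, hmin⟩ := hS.exists_isMinOn hne hc.continuousOn
    exact ⟨h m, hpos m hm, fun x hx => hmin hx⟩

/-- Reversing tuples exchanges the two kinds of witnesses. -/
lemma RevCRWitness.swap {X : Type*} [TopologicalSpace X] {G F : Set (X × X)} {n : ℕ}
    (h : RevCRWitness G n) (hGF : ∀ q ∈ G, q.swap ∈ F) : CRWitness F n := by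
  obtain ⟨K, L, hKn, hLn, hK, hL, hKG, hLG, hd, hsub⟩ := h
  let r : (Fin (n + 1) → X) → (Fin (n + 1) → X) := fun x i => x i.rev
  have hr : Continuous r := continuous_pi fun i => continuous_apply _
  have hrr : ∀ x, r (r x) = x := fun x => by funext i; simp [r]
  have hne : ∀ A : Set (Fin (n + 1) → X), A.Nonempty → (r ⁻¹' A).Nonempty :=
    fun A ⟨x, hx⟩ => ⟨r x, by simpa [hrr] using hx⟩
  have hmah : ∀ A : Set (Fin (n + 1) → X), A ⊆ Mahavier G n → r ⁻¹' A ⊆ Mahavier F n := by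
    intro A hA x hx i
    have := hGF _ (hA hx i.rev)
    simpa [r, Fin.rev_castSucc, Fin.rev_succ] using this
  have hfirst : ∀ A : Set (Fin (n + 1) → X),
      (fun x : Fin (n + 1) → X => x 0) '' (r ⁻¹' A) = (fun x => x (Fin.last n)) '' A := by
    intro A
    ext y
    constructor
    · rintro ⟨x, hx, rfl⟩
      exact ⟨r x, hx, by simp [r]⟩
    · rintro ⟨x, hx, rfl⟩
      exact ⟨r x, by simpa [hrr] using hx, by simp [r]⟩
  have hlast : ∀ A : Set (Fin (n + 1) → X),
      (fun x : Fin (n + 1) → X => x (Fin.last n)) '' (r ⁻¹' A) = (fun x => x 0) '' A := by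
    intro A
    ext y
    constructor
    · rintro ⟨x, hx, rfl⟩
      exact ⟨r x, hx, by simp [r]⟩
    · rintro ⟨x, hx, rfl⟩
      exact ⟨r x, by simpa [hrr] using hx, by simp [r]⟩
  refine ⟨r ⁻¹' K, r ⁻¹' L, hne K hKn, hne L hLn, hK.preimage hr, hL.preimage hr,
    hmah K hKG, hmah L hLG, hd.preimage r, ?_⟩
  simpa only [hfirst, hlast] using hsub

lemma IsClosed.mahavier {X : Type*} [TopologicalSpace X] {F : Set (X × X)} (hF : IsClosed F)
    (n : ℕ) : IsClosed (Mahavier F n) := by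
  have : Mahavier F n = ⋂ i : Fin n, (fun x => (x i.castSucc, x i.succ)) ⁻¹' F := by
    ext x
    simp [Mahavier]
  rw [this]
  exact isClosed_iInter fun i => hF.preimage (by fun_prop)

/-- Iterating an expanding partial rule `u` on `(0, p]` and a contracting rule `d` elsewhere
moves `[e, 1]` into `[c, 1]` in a uniformly bounded number of steps. -/
lemma exists_iterate_ge {σ : ℝ → ℝ} {c e p δ : ℝ} (hδ : 0 < δ)
    (hup : ∀ y, e ≤ y → y ≤ p → y + δ ≤ σ y) (hdown : ∀ y, p < y → y ≤ 1 → c ≤ σ y)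
    (hle : ∀ y, 0 < y → y ≤ 1 → σ y ≤ 1) (he : 0 < e) (hec : e ≤ c) :
    ∃ m : ℕ, ∀ y, e ≤ y → y ≤ 1 → c ≤ σ^[m] y := by
  have key : ∀ (i : ℕ) (y : ℝ), e ≤ y → y ≤ 1 →
      min c (e + i * δ) ≤ σ^[i] y ∧ e ≤ σ^[i] y ∧ σ^[i] y ≤ 1 := by
    intro i y hy hy1
    induction i with
    | zero => simp [hy, hy1]
    | succ i ih =>
      obtain ⟨h1, h2, h3⟩ := ih
      rw [Function.iterate_succ_apply']
      have h4 := hle _ (he.trans_le h2) h3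
      rcases le_or_gt (σ^[i] y) p with hp | hp
      · have h5 := hup _ h2 hp
        refine ⟨?_, by linarith, h4⟩
        push_cast
        rcases min_le_iff.1 h1 with h | h
        · exact min_le_of_left_le (by linarith)
        · exact min_le_of_right_le (by linarith)
      · have h5 := hdown _ hp h3
        exact ⟨min_le_of_left_le h5, by linarith, h4⟩
  obtain ⟨m, hm⟩ := exists_nat_gt ((c - e) / δ)
  refine ⟨m, fun y hy hy1 => ?_⟩
  have h := (key m y hy hy1).1
  rw [div_lt_iff₀ hδ] at hm
  rwa [min_eq_left (by linarith)] at h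

/-- A union of a compact relation `U` moving points up, defined on `(0, p]`, and a compact
relation `D` moving points down, defined on `(0, 1]`, is reverse CR-turbulent. -/
lemma exists_revCRWitness_union {U D : Set (ℝ × ℝ)} {p : ℝ} (hp0 : 0 < p) (hp1 : p < 1)
    (hU : IsCompact U) (hD : IsCompact D)
    (hUex : ∀ y, 0 < y → y ≤ p → ∃ x, (y, x) ∈ U)
    (hDex : ∀ y, 0 < y → y ≤ 1 → ∃ x, (y, x) ∈ D)
    (hUlt : ∀ q ∈ U, 0 < q.1 → q.1 < q.2 ∧ q.2 ≤ 1)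
    (hDlt : ∀ q ∈ D, 0 < q.1 → 0 < q.2 ∧ q.2 < q.1) :
    ∃ n : ℕ, 1 ≤ n ∧ RevCRWitness (U ∪ D) n := by
  have hstepU : ∀ e > 0, ∃ δ > 0, ∀ q ∈ U, e ≤ q.1 → q.1 + δ ≤ q.2 := by
    intro e he
    obtain ⟨δ, hδ, h⟩ := (hU.inter_right
      (isClosed_le continuous_const continuous_fst : IsClosed {q : ℝ × ℝ | e ≤ q.1})
      ).exists_pos_le_of_forall_pos (h := fun q => q.2 - q.1) (by fun_prop)
      (fun q hq => sub_pos.2 (hUlt q hq.1 (he.trans_le hq.2)).1)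
    exact ⟨δ, hδ, fun q hq hq' => by linarith [h q ⟨hq, hq'⟩]⟩
  have hstepD : ∀ e > 0, ∃ δ > 0, ∀ q ∈ D, e ≤ q.1 → δ ≤ q.2 ∧ q.2 + δ ≤ q.1 := by
    intro e he
    obtain ⟨δ, hδ, h⟩ := (hD.inter_right
      (isClosed_le continuous_const continuous_fst : IsClosed {q : ℝ × ℝ | e ≤ q.1})
      ).exists_pos_le_of_forall_pos (h := fun q => min q.2 (q.1 - q.2)) (by fun_prop)
      (fun q hq => lt_min (hDlt q hq.1 (he.trans_le hq.2)).1
        (sub_pos.2 (hDlt q hq.1 (he.trans_le hq.2)).2))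
    refine ⟨δ, hδ, fun q hq hq' => ?_⟩
    have := le_min_iff.1 (h q ⟨hq, hq'⟩)
    exact ⟨this.1, by linarith [this.2]⟩
  choose! u hu using hUex
  choose! d hd using hDex
  have hd0 : ∀ y, 0 < y → y ≤ 1 → 0 < d y := fun y h h' => (hDlt _ (hd y h h') h).1
  have hdlt : ∀ y, 0 < y → y ≤ 1 → d y < y := fun y h h' => (hDlt _ (hd y h h') h).2
  have hult : ∀ y, 0 < y → y ≤ p → y < u y := fun y h h' => (hUlt _ (hu y h h') h).1
  have hu1 : ∀ y, 0 < y → y ≤ p → u y ≤ 1 := fun y h h' => (hUlt _ (hu y h h') h).2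
  obtain ⟨c, hc0, hc⟩ := hstepD p hp0
  have hc1 : c ≤ 1 := by
    have h1 := (hc _ (hd 1 one_pos le_rfl) hp1.le).1
    have h2 := hdlt 1 one_pos le_rfl
    simp only at h1
    linarith
  have hdit : ∀ (i : ℕ) (y : ℝ), 0 < y → y ≤ 1 →
      0 < d^[i] y ∧ d^[i] y ≤ 1 ∧ d^[i] y ≤ max p (1 - i * c) := by
    intro i y hy hy1
    induction i with
    | zero => simp [hy, hy1]
    | succ i ih =>
      obtain ⟨h1, h2, h3⟩ := ih
      rw [Function.iterate_succ_apply']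
      have h4 := hdlt _ h1 h2
      refine ⟨hd0 _ h1 h2, by linarith, ?_⟩
      rcases le_or_gt (d^[i] y) p with h | h
      · exact le_max_of_le_left (by linarith)
      · have h5 := (hc _ (hd _ h1 h2) h.le).2
        simp only at h5
        rcases le_max_iff.1 h3 with h6 | h6
        · linarith
        · exact le_max_of_le_right (by push_cast; linarith)
  obtain ⟨k, hk⟩ := exists_nat_gt (1 / c)
  rw [div_lt_iff₀ hc0] at hk
  have hkp : ∀ y, 0 < y → y ≤ 1 → d^[k] y ≤ p := by
    intro y hy hy1
    have h := (hdit k y hy hy1).2.2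
    rcases le_max_iff.1 h with h | h <;> linarith
  have hlow : ∀ i : ℕ, ∃ e > 0, ∀ y, c ≤ y → y ≤ 1 → e ≤ d^[i] y := by
    intro i
    induction i with
    | zero => exact ⟨c, hc0, fun y hy _ => hy⟩
    | succ i ih =>
      obtain ⟨e, he, h⟩ := ih
      obtain ⟨δ, hδ, h'⟩ := hstepD e he
      refine ⟨δ, hδ, fun y hy hy1 => ?_⟩
      rw [Function.iterate_succ_apply']
      obtain ⟨h1, h2, -⟩ := hdit i y (hc0.trans_le hy) hy1
      exact (h' _ (hd _ h1 h2) (h y hy hy1)).1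
  obtain ⟨e', he', hlow'⟩ := hlow (k + 1)
  set e := min e' c
  have he : 0 < e := lt_min he' hc0
  obtain ⟨δ, hδ, hUδ⟩ := hstepU e he
  set σ : ℝ → ℝ := fun y => if y ≤ p then u y else d y with hσ
  have hσmem : ∀ y, 0 < y → y ≤ 1 → (y, σ y) ∈ U ∪ D := by
    intro y hy hy1
    by_cases h : y ≤ p
    · exact Or.inl (by simpa [hσ, h] using hu y hy h)
    · exact Or.inr (by simpa [hσ, h] using hd y hy hy1)
  have hσ01 : ∀ y, 0 < y → y ≤ 1 → 0 < σ y ∧ σ y ≤ 1 := by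
    intro y hy hy1
    by_cases h : y ≤ p
    · simp only [hσ, h, if_true]
      exact ⟨hy.trans (hult y hy h), hu1 y hy h⟩
    · simp only [hσ, h, if_false]
      exact ⟨hd0 y hy hy1, by linarith [hdlt y hy hy1]⟩
  obtain ⟨m, hm⟩ : ∃ m : ℕ, ∀ y, e ≤ y → y ≤ 1 → c ≤ σ^[m] y := by
    refine exists_iterate_ge (p := p) hδ ?_ ?_ (fun y h h' => (hσ01 y h h').2) he
      (min_le_right _ _)
    · intro y hy hyp
      simpa [hσ, hyp] using hUδ _ (hu y (he.trans_le hy) hyp) hy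
    · intro y hy hy1
      simpa [hσ, not_le.2 hy] using (hc _ (hd y (hp0.trans hy) hy1) hy.le).1
  have hσit : ∀ (i : ℕ) (y : ℝ), 0 < y → y ≤ 1 → 0 < σ^[i] y ∧ σ^[i] y ≤ 1 := by
    intro i y hy hy1
    induction i with
    | zero => exact ⟨hy, hy1⟩
    | succ i ih =>
      rw [Function.iterate_succ_apply']
      exact hσ01 _ ih.1 ih.2
  let n := k + 1 + m
  let j : Fin n := ⟨k, by omega⟩
  let W : Set (ℝ × ℝ) → Set (Fin (n + 1) → ℝ) := fun V =>
    Mahavier (U ∪ D) n ∩ {x | (x j.castSucc, x j.succ) ∈ V} ∩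
      ({x | x 0 ∈ Icc c 1} ∩ {x | x (Fin.last n) ∈ Icc c 1})
  have hWclosed : ∀ V, IsClosed V → IsClosed (W V) := fun V hV =>
    (((hU.isClosed.union hD.isClosed).mahavier n).inter (hV.preimage (by fun_prop))).inter
      ((isClosed_Icc.preimage (continuous_apply _)).inter
        (isClosed_Icc.preimage (continuous_apply _)))
  have horbit : ∀ V ⊆ U ∪ D, ∀ t : ℝ → ℝ, (∀ y, 0 < y → y ≤ p → (y, t y) ∈ V) →
      (∀ y, c ≤ y → y ≤ 1 → e ≤ t (d^[k] y) ∧ t (d^[k] y) ≤ 1) →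
      Icc c 1 ⊆ (fun x => x 0) '' W V := by
    rintro V hV t htV ht y ⟨hy, hy1⟩
    have hy0 := hc0.trans_le hy
    obtain ⟨ht0, ht1⟩ := ht y hy hy1
    let s : ℕ → ℝ := fun i => if i ≤ k then d^[i] y else σ^[i - (k + 1)] (t (d^[k] y))
    have hsk : (s k, s (k + 1)) ∈ V := by
      simpa [s] using htV _ (hdit k y hy0 hy1).1 (hkp y hy0 hy1)
    refine ⟨fun i => s i, ⟨⟨fun i => ?_, ?_⟩, ?_, ?_⟩, ?_⟩
    · simp only [Fin.val_castSucc, Fin.val_succ]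
      rcases lt_trichotomy (i : ℕ) k with h | h | h
      · have h1 : (i : ℕ) + 1 ≤ k := h
        simp only [s, h.le, h1, if_true, Function.iterate_succ_apply']
        exact Or.inr (hd _ (hdit _ y hy0 hy1).1 (hdit _ y hy0 hy1).2.1)
      · rw [h]
        exact hV hsk
      · have h1 : ¬ (i : ℕ) ≤ k := by omega
        have h2 : ¬ (i : ℕ) + 1 ≤ k := by omega
        have h3 : (i : ℕ) + 1 - (k + 1) = (i - (k + 1)) + 1 := by omega
        simp only [s, h1, h2, if_false, h3, Function.iterate_succ_apply']
        have := hσit (i - (k + 1)) _ (he.trans_le ht0) ht1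
        exact hσmem _ this.1 this.2
    · simpa [j] using hsk
    · simpa [s] using ⟨hy, hy1⟩
    · have h1 : ¬ k + 1 + m ≤ k := by omega
      have h2 : k + 1 + m - (k + 1) = m := by omega
      simp only [mem_ofPred_eq, Fin.val_last, n, s, h1, if_false, h2]
      exact ⟨hm _ ht0 ht1, (hσit m _ (he.trans_le ht0) ht1).2⟩
    · simp [s]
  have hKim := horbit U subset_union_left u hu (fun y hy hy1 => by
    obtain ⟨h1, h2, -⟩ := hdit k y (hc0.trans_le hy) hy1
    have h3 := hkp y (hc0.trans_le hy) hy1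
    refine ⟨?_, hu1 _ h1 h3⟩
    have h4 := hlow' y hy hy1
    rw [Function.iterate_succ_apply'] at h4
    linarith [hdlt _ h1 h2, hult _ h1 h3, min_le_left e' c])
  have hLim := horbit D subset_union_right d (fun y h h' => hd y h (h'.trans hp1.le))
    (fun y hy hy1 => by
      have h4 := hlow' y hy hy1
      have h5 := (hdit (k + 1) y (hc0.trans_le hy) hy1).2.1
      rw [Function.iterate_succ_apply'] at h4 h5
      exact ⟨(min_le_left _ _).trans h4, h5⟩)
  have hpos : ∀ x ∈ Mahavier (U ∪ D) n, 0 < x 0 → ∀ i, 0 < x i := by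
    intro x hx h0 i
    induction i using Fin.induction with
    | zero => exact h0
    | succ i ih =>
      rcases hx i with h | h
      · exact ih.trans (hUlt _ h ih).1
      · exact (hDlt _ h ih).1
  refine ⟨n, by omega, W U, W D, ?_, ?_, hWclosed U hU.isClosed, hWclosed D hD.isClosed,
    fun x hx => hx.1.1, fun x hx => hx.1.1, ?_, ?_⟩
  · exact Set.image_nonempty.1 ⟨1, hKim ⟨hc1, le_rfl⟩⟩
  · exact Set.image_nonempty.1 ⟨1, hLim ⟨hc1, le_rfl⟩⟩
  · refine Set.disjoint_left.2 fun x hxU hxD => ?_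
    have h0 := hpos x hxU.1.1 (hc0.trans_le hxU.2.1.1) j.castSucc
    exact lt_asymm (hUlt _ hxU.1.2 h0).1 (hDlt _ hxD.1.2 h0).2
  · refine Set.Subset.trans ?_ (Set.subset_inter hKim hLim)
    rintro _ (⟨x, hx, rfl⟩ | ⟨x, hx, rfl⟩) <;> exact hx.2.2

lemma isCompact_setOf_graphOn {f : ℝ → ℝ} {s : Set ℝ} (hs : IsCompact s)
    (hf : ContinuousOn f s) : IsCompact {p : ℝ × ℝ | p.1 ∈ s ∧ p.2 = f p.1} := by
  have h : {p : ℝ × ℝ | p.1 ∈ s ∧ p.2 = f p.1} = (fun x => (x, f x)) '' s := by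
    ext ⟨x, y⟩
    constructor
    · rintro ⟨hx, hy⟩
      exact ⟨x, hx, Prod.ext rfl hy.symm⟩
    · rintro ⟨z, hz, hzx⟩
      obtain ⟨rfl, rfl⟩ := Prod.mk.inj hzx
      exact ⟨hz, rfl⟩
  rw [h]
  exact hs.image_of_continuousOn (continuousOn_id.prodMk hf)

/-- With `f, g` as in the standing assumptions, the closed relation
`f ∪ g = Γ(f) ∪ Γ(g)` on `[0,1]` is both CR-turbulent and reverse CR-turbulent. -/
theorem stmt14 (a b : ℝ) (f g : ℝ → ℝ) (ha0 : 0 < a) (ha1 : a < 1)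
    (hfc : ContinuousOn f (Set.Icc 0 a)) (hfi : Set.InjOn f (Set.Icc 0 a))
    (hfm : Set.MapsTo f (Set.Icc 0 a) (Set.Icc 0 1))
    (hf0 : f 0 = 0) (hfa : f a = 1) (hfgt : ∀ x, 0 < x → x ≤ a → x < f x)
    (hb0 : 0 < b) (hb1 : b < 1)
    (hgc : ContinuousOn g (Set.Icc 0 1)) (hgi : Set.InjOn g (Set.Icc 0 1))
    (hgm : Set.MapsTo g (Set.Icc 0 1) (Set.Icc 0 1))
    (hg0 : g 0 = 0) (hg1 : g 1 = b) (hglt : ∀ x, 0 < x → x ≤ 1 → g x < x) :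
    CRTurbulent ({p : ℝ × ℝ | p.1 ∈ Set.Icc 0 a ∧ p.2 = f p.1} ∪
        {p : ℝ × ℝ | p.1 ∈ Set.Icc 0 1 ∧ p.2 = g p.1}) ∧
    RevCRTurbulent ({p : ℝ × ℝ | p.1 ∈ Set.Icc 0 a ∧ p.2 = f p.1} ∪
        {p : ℝ × ℝ | p.1 ∈ Set.Icc 0 1 ∧ p.2 = g p.1}) := by
  set Γf := {p : ℝ × ℝ | p.1 ∈ Set.Icc 0 a ∧ p.2 = f p.1}
  set Γg := {p : ℝ × ℝ | p.1 ∈ Set.Icc 0 1 ∧ p.2 = g p.1}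
  have hcf : IsCompact Γf := isCompact_setOf_graphOn isCompact_Icc hfc
  have hcg : IsCompact Γg := isCompact_setOf_graphOn isCompact_Icc hgc
  have hgpos : ∀ x, 0 < x → x ≤ 1 → 0 < g x := by
    intro x hx hx1
    refine (hgm ⟨hx.le, hx1⟩).1.lt_of_ne fun h => hx.ne ?_
    exact hgi ⟨le_rfl, zero_le_one⟩ ⟨hx.le, hx1⟩ (hg0.trans h)
  constructor
  · suffices h : ∃ n : ℕ, 1 ≤ n ∧ RevCRWitness (Prod.swap '' Γg ∪ Prod.swap '' Γf) n by
      obtain ⟨n, hn, h⟩ := h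
      refine ⟨n, hn, h.swap ?_⟩
      rintro _ (⟨q, hq, rfl⟩ | ⟨q, hq, rfl⟩)
      · exact Or.inr hq
      · exact Or.inl hq
    refine exists_revCRWitness_union hb0 hb1 (hcg.image continuous_swap)
      (hcf.image continuous_swap) ?_ ?_ ?_ ?_
    · intro y hy hyb
      obtain ⟨x, hx, hxy⟩ := intermediate_value_Icc zero_le_one hgc
        (show y ∈ Icc (g 0) (g 1) from ⟨hg0.le.trans hy.le, hyb.trans hg1.ge⟩)
      exact ⟨x, (x, y), ⟨hx, hxy.symm⟩, rfl⟩
    · intro y hy hy1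
      obtain ⟨x, hx, hxy⟩ := intermediate_value_Icc ha0.le hfc
        (show y ∈ Icc (f 0) (f a) from ⟨hf0.le.trans hy.le, hy1.trans hfa.ge⟩)
      exact ⟨x, (x, y), ⟨hx, hxy.symm⟩, rfl⟩
    · rintro _ ⟨⟨x, y⟩, ⟨hx, hxy : y = g x⟩, rfl⟩ (hy : 0 < y)
      have hx0 : 0 < x := hx.1.lt_of_ne fun h : 0 = x => by
        rw [hxy, ← h, hg0] at hy
        exact hy.false
      exact ⟨show y < x from hxy ▸ hglt x hx0 hx.2, hx.2⟩
    · rintro _ ⟨⟨x, y⟩, ⟨hx, hxy : y = f x⟩, rfl⟩ (hy : 0 < y)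
      have hx0 : 0 < x := hx.1.lt_of_ne fun h : 0 = x => by
        rw [hxy, ← h, hf0] at hy
        exact hy.false
      exact ⟨hx0, show x < y from hxy ▸ hfgt x hx0 hx.2⟩
  · refine exists_revCRWitness_union ha0 ha1 hcf hcg
      (fun y hy hya => ⟨f y, ⟨hy.le, hya⟩, rfl⟩) (fun y hy hy1 => ⟨g y, ⟨hy.le, hy1⟩, rfl⟩) ?_ ?_
    · rintro ⟨x, y⟩ ⟨hx, hxy : y = f x⟩ (hx0 : 0 < x)
      exact hxy ▸ ⟨hfgt x hx0 hx.2, (hfm hx).2⟩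
    · rintro ⟨x, y⟩ ⟨hx, hxy : y = g x⟩ (hx0 : 0 < x)
      exact hxy ▸ ⟨hgpos x hx0 hx.2, hglt x hx0 hx.2⟩
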